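/- arXiv:2602.19573 — 2 statements merged into one kernel-verified Lean document; each statement's English description precedes it below -/
import Mathlib

section
/- Let d > 2 be a prime integer. For all n, m ∈ {0,…,d−1} there exist k, p, q ∈ {0,…,d−1} such that C_d U_{n,m} C_d = w^k · Π_{p,q}; that is, conjugating any Weyl matrix by the Chrestenson matrix yields a Kronecker–Pauli matrix up to a d-th root of unity phase. -/
open Matrix BigOperators

/-- The primitive `d`-th root of unity `w = exp(2πi/d)`. -/
noncomputable def ω (d : ℕ) : ℂ := Complex.exp (2 * Real.pi * Complex.I / d)

/-- The Chrestenson matrix: `(C_d)_{y,x} = w^{x·y} / √d`. -/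
noncomputable def chres (d : ℕ) : Matrix (Fin d) (Fin d) ℂ :=
  Matrix.of fun y x => ω d ^ ((x : ℕ) * (y : ℕ)) / (Real.sqrt d : ℂ)

/-- The Weyl matrix: `(U_{n,m})_{k,j} = w^{k·n}` if `j ≡ k + m (mod d)`, and `0` otherwise. -/
noncomputable def weyl (d n m : ℕ) : Matrix (Fin d) (Fin d) ℂ :=
  Matrix.of fun k j => if (j : ℕ) = ((k : ℕ) + m) % d then ω d ^ ((k : ℕ) * n) else 0

/-- The Kronecker–Pauli matrix: `(Π_{n,m})_{k,j} = w^{(k-n)·m}` if `j ≡ -k + 2n (mod d)`,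
and `0` otherwise. -/
noncomputable def kp (d n m : ℕ) : Matrix (Fin d) (Fin d) ℂ :=
  Matrix.of fun k j =>
    if (j : ℤ) = (-(k : ℤ) + 2 * (n : ℤ)) % (d : ℤ) then ω d ^ (((k : ℤ) - (n : ℤ)) * (m : ℤ))
    else 0

theorem isPrimitiveRoot_ω {d : ℕ} (hd : d ≠ 0) : IsPrimitiveRoot (ω d) d :=
  Complex.isPrimitiveRoot_exp d hd

/-- Orthogonality of the characters of `ℤ/d`. -/
theorem sum_ω_pow_mul {d : ℕ} (hd : d ≠ 0) (s : ℕ) :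
    ∑ x : Fin d, ω d ^ ((x : ℕ) * s) = if d ∣ s then (d : ℂ) else 0 := by
  have h := isPrimitiveRoot_ω hd
  split_ifs with hs
  · have h1 : ω d ^ s = 1 := (h.pow_eq_one_iff_dvd s).2 hs
    simp [mul_comm _ s, pow_mul, h1]
  · have h1 : ω d ^ s ≠ 1 := fun h1 => hs ((h.pow_eq_one_iff_dvd s).1 h1)
    have h2 := mul_neg_geom_sum (ω d ^ s) d
    rw [← pow_mul, mul_comm s d, pow_mul, h.pow_eq_one, one_pow, sub_self] at h2
    have h3 := (mul_eq_zero.1 h2).resolve_left (sub_ne_zero.2 h1.symm)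
    rw [← Fin.sum_univ_eq_sum_range] at h3
    simpa only [← pow_mul, mul_comm s] using h3

theorem weyl_mul_chres_apply {d : ℕ} (hd : d ≠ 0) (n m : ℕ) (x z : Fin d) :
    (weyl d n m * chres d) x z =
      ω d ^ ((x : ℕ) * n + (z : ℕ) * (x + m)) / (Real.sqrt d : ℂ) := by
  rw [Matrix.mul_apply,
    Finset.sum_eq_single (⟨(x + m) % d, Nat.mod_lt _ (Nat.pos_of_ne_zero hd)⟩ : Fin d)]
  · have h : ω d ^ ((z : ℕ) * ((x + m) % d)) = ω d ^ ((z : ℕ) * (x + m)) := by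
      have hmod := pow_mod_orderOf (ω d) (x + m)
      rw [← (isPrimitiveRoot_ω hd).eq_orderOf] at hmod
      rw [mul_comm, pow_mul, hmod, ← pow_mul, mul_comm]
    simp [weyl, chres, pow_add, mul_div_assoc, h]
  · intro j _ hj
    have : (j : ℕ) ≠ (x + m) % d := fun h => hj (Fin.ext h)
    simp [weyl, this]
  · simp

theorem chres_mul_weyl_mul_chres_apply {d : ℕ} (hd : d ≠ 0) (n m : ℕ) (y z : Fin d) :
    (chres d * weyl d n m * chres d) y z =
      if d ∣ (y : ℕ) + n + z then ω d ^ (m * (z : ℕ)) else 0 := by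
  have hs : (Real.sqrt d : ℂ) * (Real.sqrt d : ℂ) = d := by
    rw [← Complex.ofReal_mul, Real.mul_self_sqrt (Nat.cast_nonneg d), Complex.ofReal_natCast]
  have hd' : (d : ℂ) ≠ 0 := Nat.cast_ne_zero.2 hd
  rw [mul_assoc, Matrix.mul_apply]
  calc ∑ x, chres d y x * (weyl d n m * chres d) x z
      = ∑ x : Fin d, ω d ^ (m * (z : ℕ)) / d * ω d ^ ((x : ℕ) * (y + n + z)) := by
        refine Finset.sum_congr rfl fun x _ => ?_
        rw [weyl_mul_chres_apply hd, chres, Matrix.of_apply, div_mul_div_comm, hs, ← pow_add,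
          div_mul_eq_mul_div, ← pow_add]
        ring_nf
    _ = _ := by
        rw [← Finset.mul_sum, sum_ω_pow_mul hd]
        split_ifs <;> simp [hd']

theorem chres_weyl_chres_eq_phase_kp (d : ℕ) (hd : d.Prime) (hd2 : 2 < d)
    (n m : ℕ) (hn : n < d) (hm : m < d) :
    ∃ k p q : ℕ, k < d ∧ p < d ∧ q < d ∧
      chres d * weyl d n m * chres d = ω d ^ k • kp d p q := by
  have hd0 : d ≠ 0 := hd.ne_zero
  have hpos : 0 < d := hd.pos
  have h := isPrimitiveRoot_ω hd0
  obtain ⟨e, he⟩ : Odd d := hd.odd_of_ne_two hd2.ne'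
  have mod_eq (a : ℕ) : ∃ c : ℤ, ((a % d : ℕ) : ℤ) = a + d * c :=
    ⟨-(a / d : ℕ), by have := Nat.mod_add_div a d; zify at this ⊢; linarith⟩
  obtain ⟨a, ha⟩ := mod_eq (n * e)
  obtain ⟨b, hb⟩ := mod_eq (m * (d - 1))
  obtain ⟨c, hc⟩ := mod_eq (m * (n * e % d))
  refine ⟨m * (n * e % d) % d, n * e % d, m * (d - 1) % d, Nat.mod_lt _ hpos,
    Nat.mod_lt _ hpos, Nat.mod_lt _ hpos, ?_⟩
  generalize n * e % d = p at *
  generalize m * (d - 1) % d = q at *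
  generalize m * p % d = k at *
  push_cast [Nat.cast_sub hpos] at ha hb hc
  have heZ : (d : ℤ) = 2 * e + 1 := by exact_mod_cast he
  have hp : 2 * (p : ℤ) = -n + d * (n + 2 * a) := by rw [ha, heZ]; ring
  ext y z
  rw [chres_mul_weyl_mul_chres_apply hd0, Matrix.smul_apply, kp, Matrix.of_apply, smul_eq_mul]
  have hiff : d ∣ (y : ℕ) + n + z ↔ (z : ℤ) = (-(y : ℤ) + 2 * (p : ℤ)) % (d : ℤ) := by
    have hz : (z : ℤ) % d = z :=
      Int.emod_eq_of_lt (Int.natCast_nonneg _) (by exact_mod_cast z.isLt)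
    rw [← Int.natCast_dvd_natCast]
    conv_rhs => rw [← hz]
    rw [← Int.ModEq, Int.modEq_comm, Int.modEq_iff_dvd, hp,
      ← dvd_add_left (Dvd.intro (-(n + 2 * a)) rfl : (d : ℤ) ∣ d * -(n + 2 * a))]
    push_cast
    ring_nf
  by_cases hz : d ∣ (y : ℕ) + n + z
  · rw [if_pos hz, if_pos (hiff.1 hz), ← zpow_natCast, ← zpow_natCast,
      ← zpow_add₀ (h.ne_zero hd0), ← sub_add_cancel ((m * (z : ℕ) : ℕ) : ℤ)
        ((k : ℤ) + ((y : ℤ) - p) * q), zpow_add₀ (h.ne_zero hd0),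
      (h.zpow_eq_one_iff_dvd _).2, one_mul]
    obtain ⟨t, ht⟩ := hz
    have ht' : (y : ℤ) + n + z = d * t := by exact_mod_cast ht
    refine ⟨m * t - m * (n + 2 * a) - c - (y - p) * (m + b), ?_⟩
    rw [hc, hb]
    push_cast
    linear_combination (m : ℤ) * ht' - (m : ℤ) * hp
  · rw [if_neg hz, if_neg (hiff.not.1 hz), mul_zero]
end

section
/- For every prime integer d > 2, the d² Kronecker–Pauli matrices form a basis of the space of d×d complex matrices: every d×d complex matrix M satisfies M = (1/d) · Σ_{n,m=0}^{d−1} Tr(Π_{n,m} M) · Π_{n,m}. -/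
open Matrix BigOperators

theorem sum_ω_zpow {d : ℕ} (hd : d ≠ 0) (z : ℤ) :
    ∑ m : Fin d, ω d ^ (z * ((m : ℕ) : ℤ)) = if (d : ℤ) ∣ z then (d : ℂ) else 0 := by
  have hω := isPrimitiveRoot_ω hd
  have hpow : ∀ m : ℕ, ω d ^ (z * (m : ℤ)) = (ω d ^ z) ^ m := fun m => by
    rw [_root_.zpow_mul, zpow_natCast]
  simp only [hpow]
  rw [Fin.sum_univ_eq_sum_range (fun m => (ω d ^ z) ^ m) d]
  split_ifs with h
  · simp [(hω.zpow_eq_one_iff_dvd z).2 h]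
  · have hne : ω d ^ z ≠ 1 := fun h1 => h ((hω.zpow_eq_one_iff_dvd z).1 h1)
    rw [geom_sum_eq hne, ← zpow_natCast, zpow_comm, zpow_natCast, hω.pow_eq_one]
    simp

theorem Fin.eq_of_intCast_dvd_sub {d : ℕ} {a b : Fin d}
    (h : (d : ℤ) ∣ ((a : ℕ) : ℤ) - ((b : ℕ) : ℤ)) : a = b := by
  have := Int.eq_zero_of_abs_lt_dvd h (by rw [abs_lt]; omega)
  omega

theorem kp_apply {d : ℕ} (n m : ℕ) (k j : Fin d) :
    kp d n m k j =
      if (d : ℤ) ∣ ((k : ℕ) : ℤ) + ((j : ℕ) : ℤ) - 2 * n then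
        ω d ^ ((((k : ℕ) : ℤ) - n) * (m : ℤ)) else 0 := by
  have hj : (((j : ℕ) : ℤ)) % d = (j : ℕ) := Int.emod_eq_of_lt (by omega) (by omega)
  have : ((j : ℕ) : ℤ) = (-((k : ℕ) : ℤ) + 2 * (n : ℤ)) % (d : ℤ) ↔
      (d : ℤ) ∣ ((k : ℕ) : ℤ) + ((j : ℕ) : ℤ) - 2 * n := by
    conv_lhs => rw [← hj, ← Int.ModEq, Int.modEq_comm, Int.modEq_iff_dvd]
    ring_nf
  simp only [kp, Matrix.of_apply, this]

theorem sum_kp_mul_kp {d : ℕ} (hd : d ≠ 0) (n : ℕ) (k j a b : Fin d) :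
    ∑ m : Fin d, kp d n m k j * kp d n m a b =
      if (d : ℤ) ∣ ((k : ℕ) : ℤ) + ((j : ℕ) : ℤ) - 2 * n ∧
          (d : ℤ) ∣ ((a : ℕ) : ℤ) + ((b : ℕ) : ℤ) - 2 * n ∧
          (d : ℤ) ∣ ((k : ℕ) : ℤ) + ((a : ℕ) : ℤ) - 2 * n then (d : ℂ) else 0 := by
  have hω : ω d ≠ 0 := (isPrimitiveRoot_ω hd).ne_zero hd
  simp only [kp_apply]
  by_cases h1 : (d : ℤ) ∣ ((k : ℕ) : ℤ) + ((j : ℕ) : ℤ) - 2 * n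
  · by_cases h2 : (d : ℤ) ∣ ((a : ℕ) : ℤ) + ((b : ℕ) : ℤ) - 2 * n
    · simp only [h1, h2, if_true, true_and, ← sum_ω_zpow hd, ← zpow_add₀ hω]
      exact Finset.sum_congr rfl fun m _ => by congr 1; ring
    · simp [h2]
  · simp [h1]

theorem Odd.exists_fin_dvd_sub_two_mul {d : ℕ} (hd : Odd d) (s : ℤ) :
    ∃ n : Fin d, ∀ n' : Fin d, (d : ℤ) ∣ s - 2 * ((n' : ℕ) : ℤ) ↔ n' = n := by
  obtain ⟨e, he⟩ := hd
  have hpos : (0 : ℤ) < d := by omega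
  have h0 := Int.emod_nonneg (s * (e + 1)) hpos.ne'
  have h1 := Int.emod_lt_of_pos (s * (e + 1)) hpos
  have hdvd : (d : ℤ) ∣ s - 2 * (s * (e + 1) % d) := by
    refine ⟨2 * (s * (e + 1) / d) - s, ?_⟩
    have h2 := Int.emod_add_mul_ediv (s * (e + 1)) d
    have h3 : (d : ℤ) = 2 * e + 1 := by exact_mod_cast he
    linear_combination -2 * h2 + s * h3
  refine ⟨⟨(s * (e + 1) % d).toNat, by omega⟩, fun n' => ⟨fun h => ?_, ?_⟩⟩
  · apply Fin.eq_of_intCast_dvd_sub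
    have hco : IsCoprime (d : ℤ) 2 := ⟨1, -e, by rw [he]; push_cast; ring⟩
    refine hco.dvd_of_dvd_mul_left ?_
    simp only [Int.toNat_of_nonneg h0]
    convert dvd_sub hdvd h using 1
    ring
  · rintro rfl
    simpa only [Int.toNat_of_nonneg h0] using hdvd

theorem sum_sum_kp_mul_kp {d : ℕ} (hd : Odd d) (k j a b : Fin d) :
    ∑ n : Fin d, ∑ m : Fin d, kp d n m k j * kp d n m a b =
      if k = b ∧ j = a then (d : ℂ) else 0 := by
  simp only [sum_kp_mul_kp hd.pos.ne']
  split_ifs with h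
  · obtain ⟨rfl, rfl⟩ := h
    obtain ⟨n, hn⟩ := hd.exists_fin_dvd_sub_two_mul (((k : ℕ) : ℤ) + ((j : ℕ) : ℤ))
    simp [add_comm ((j : ℕ) : ℤ), hn]
  · refine Finset.sum_eq_zero fun n _ => if_neg fun ⟨h1, h2, h3⟩ => h ⟨?_, ?_⟩
    · apply Fin.eq_of_intCast_dvd_sub
      convert Int.dvd_sub h3 h2 using 1
      ring
    · apply Fin.eq_of_intCast_dvd_sub
      convert Int.dvd_sub h1 h3 using 1
      ring

theorem kp_basis (d : ℕ) (hd : d.Prime) (hd2 : 2 < d) (M : Matrix (Fin d) (Fin d) ℂ) :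
    M = (1 / (d : ℂ)) •
        ∑ n : Fin d, ∑ m : Fin d,
          Matrix.trace (kp d (n : ℕ) (m : ℕ) * M) • kp d (n : ℕ) (m : ℕ) := by
  have hodd : Odd d := hd.odd_of_ne_two hd2.ne'
  have hd0 : (d : ℂ) ≠ 0 := Nat.cast_ne_zero.2 hd.ne_zero
  ext a b
  have key : ∑ n : Fin d, ∑ m : Fin d, Matrix.trace (kp d n m * M) * kp d n m a b =
      ∑ k : Fin d, ∑ j : Fin d,
        M j k * ∑ n : Fin d, ∑ m : Fin d, kp d n m k j * kp d n m a b := by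
    simp only [Matrix.trace, Matrix.diag_apply, Matrix.mul_apply, Finset.sum_mul, Finset.mul_sum]
    rw [Finset.sum_congr rfl fun n _ => Finset.sum_comm, Finset.sum_comm]
    refine Finset.sum_congr rfl fun k _ => ?_
    rw [Finset.sum_congr rfl fun n _ => Finset.sum_comm, Finset.sum_comm]
    refine Finset.sum_congr rfl fun j _ => Finset.sum_congr rfl fun n _ =>
      Finset.sum_congr rfl fun m _ => by ring
  simp only [Matrix.smul_apply, Matrix.sum_apply, smul_eq_mul, key, sum_sum_kp_mul_kp hodd,
    ite_and]
  simp
  field_simp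
end
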